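/- Let f : (0,∞) → ℝ be a convex function. For any finite-dimensional complex Hilbert space ℋ, the maximal f-divergence (ρ, σ) ↦ S_f^max(ρ‖σ) is jointly lower semicontinuous on the set of pairs of nonzero positive semidefinite operators on ℋ. -/

import Mathlib

open Filter Set Topology
open scoped ComplexOrder

noncomputable section

namespace QRenyi

attribute [local instance] Classical.propDecidable

variable {ι : Type*} [Fintype ι] [DecidableEq ι]

/-- Apply a real function to the eigenvalues of a Hermitian matrix (functional calculus);
junk value `0` for non-Hermitian matrices. -/
noncomputable def hermApply (f : ℝ → ℝ) (A : Matrix ι ι ℂ) : Matrix ι ι ℂ :=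
  if hA : A.IsHermitian then hA.cfc f else 0

/-- Real power of a positive semidefinite matrix, taken on its support:
`t ↦ t ^ x` is applied to the nonzero eigenvalues and `0` is mapped to `0`.
In particular `matPow A 0` is the support projection of `A`. -/
noncomputable def matPow (A : Matrix ι ι ℂ) (x : ℝ) : Matrix ι ι ℂ :=
  hermApply (fun t => if t = 0 then 0 else t ^ x) A

/-- Logarithm of a positive semidefinite matrix taken on its support
(`Real.log 0 = 0` in Mathlib, matching the convention `log̃ 0 = 0`). -/
noncomputable def matLog (A : Matrix ι ι ℂ) : Matrix ι ι ℂ :=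
  hermApply Real.log A

/-- `supp ρ ≤ supp σ`, expressed (for PSD matrices) as inclusion of kernels. -/
def suppLE (ρ σ : Matrix ι ι ℂ) : Prop :=
  ∀ v : ι → ℂ, σ.mulVec v = 0 → ρ.mulVec v = 0

/-- The Loewner (positive semidefinite) order. -/
def loewnerLE (A B : Matrix ι ι ℂ) : Prop := (B - A).PosSemidef

/-- Real part of the trace. -/
noncomputable def reTrace (A : Matrix ι ι ℂ) : ℝ := A.trace.re

/-- The trace quantity `Tr ((σ^{(1-α)/(2z)} ρ^{α/z} σ^{(1-α)/(2z)})^z)` (a real number). -/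
noncomputable def Qaz (α z : ℝ) (ρ σ : Matrix ι ι ℂ) : ℝ :=
  reTrace (matPow (matPow σ ((1 - α) / (2 * z)) * matPow ρ (α / z) *
    matPow σ ((1 - α) / (2 * z))) z)

/-- The Rényi `(α,z)`-divergence (for `α ≠ 1`), with values in `EReal = ℝ ∪ {±∞}`.
It equals `(α-1)⁻¹ (log Q_{α,z}(ρ‖σ) - log Tr ρ)`; it is `+∞` when `α > 1` and
`supp ρ ≰ supp σ`, and also `+∞` when `α < 1` and `Q_{α,z}(ρ‖σ) = 0`
(i.e. `(α-1)⁻¹ log 0 = +∞`). -/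
noncomputable def Daz (α z : ℝ) (ρ σ : Matrix ι ι ℂ) : EReal :=
  if (suppLE ρ σ ∨ α < 1) ∧ Qaz α z ρ σ ≠ 0 then
    (((α - 1)⁻¹ * (Real.log (Qaz α z ρ σ) - Real.log (reTrace ρ)) : ℝ) : EReal)
  else ⊤

/-- The (normalized) Umegaki relative entropy. -/
noncomputable def DUm (ρ σ : Matrix ι ι ℂ) : EReal :=
  if suppLE ρ σ then
    (((reTrace ρ)⁻¹ * reTrace (ρ * (matLog ρ - matLog σ)) : ℝ) : EReal)
  else ⊤

/-- The Rényi `(α,z)`-divergence, with `D_{1,z} := D^Um`. -/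
noncomputable def Dfull (α z : ℝ) (ρ σ : Matrix ι ι ℂ) : EReal :=
  if α = 1 then DUm ρ σ else Daz α z ρ σ

/-- The max-relative entropy `D_max(ρ‖σ) = log inf {λ > 0 : ρ ≤ λ σ}`. -/
noncomputable def Dmax (ρ σ : Matrix ι ι ℂ) : EReal :=
  if ∃ c : ℝ, 0 < c ∧ loewnerLE ρ (c • σ) then
    ((Real.log (sInf {c : ℝ | 0 < c ∧ loewnerLE ρ (c • σ)}) : ℝ) : EReal)
  else ⊤

/-- The classical quantity `Q_α^cl(ρ‖σ) = ∑_x ρ(x)^α σ(x)^{1-α}` (with `0^t = 0` for `t ≠ 0`). -/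
noncomputable def Qcl {X : Type*} [Fintype X] (α : ℝ) (ρ σ : X → ℝ) : ℝ :=
  ∑ x, ρ x ^ α * σ x ^ (1 - α)

/-- Absolute continuity `ρ ≪ σ` for functions on a finite set. -/
def acl {X : Type*} (ρ σ : X → ℝ) : Prop := ∀ x, σ x = 0 → ρ x = 0

/-- The classical Rényi `α`-divergence, with values in `EReal`; for `α = 1` it is the
(normalized) Kullback-Leibler divergence. -/
noncomputable def Dcl {X : Type*} [Fintype X] (α : ℝ) (ρ σ : X → ℝ) : EReal :=
  if α = 1 then
    (if acl ρ σ then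
      ((((∑ x, ρ x)⁻¹ * ∑ x, ρ x * (Real.log (ρ x) - Real.log (σ x))) : ℝ) : EReal)
     else ⊤)
  else if (acl ρ σ ∨ α < 1) ∧ Qcl α ρ σ ≠ 0 then
    ((((α - 1)⁻¹ * (Real.log (Qcl α ρ σ) - Real.log (∑ x, ρ x))) : ℝ) : EReal)
  else ⊤

/-- The measured Rényi `α`-divergence: supremum over all finite-outcome POVMs. -/
noncomputable def Dmeas (α : ℝ) (ρ σ : Matrix ι ι ℂ) : EReal :=
  ⨆ (k : ℕ) (M : Fin k → Matrix ι ι ℂ)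
    (_ : (∀ i, (M i).PosSemidef) ∧ ∑ i, M i = 1),
    Dcl α (fun i => reTrace (M i * ρ)) (fun i => reTrace (M i * σ))

/-- A `κ`-function: a continuous nonnegative function on `[0,∞)` with
`limsup_{x→0⁺} f(x) x^{-κ} < ∞`. -/
def IsKappaFunction (κ : ℝ) (f : ℝ → ℝ) : Prop :=
  ContinuousOn f (Set.Ici 0) ∧ (∀ x ∈ Set.Ici (0 : ℝ), 0 ≤ f x) ∧
    ∃ M : ℝ, ∀ᶠ x in 𝓝[>] (0 : ℝ), f x ≤ M * x ^ κ

/-- A strict `κ`-function: a `κ`-function with `liminf_{x→0⁺} f(x) x^{-κ} > 0`. -/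
def IsStrictKappaFunction (κ : ℝ) (f : ℝ → ℝ) : Prop :=
  IsKappaFunction κ f ∧ ∃ c : ℝ, 0 < c ∧ ∀ᶠ x in 𝓝[>] (0 : ℝ), c * x ^ κ ≤ f x

/-- Nonzero PSD matrix predicate. -/
def PSDne (A : Matrix ι ι ℂ) : Prop := A.PosSemidef ∧ A ≠ 0


/-- `lim_{t→0⁺} f(t)` as an extended real (for convex `f` the limit exists and equals
this limsup). -/
noncomputable def perspLimZero (f : ℝ → ℝ) : EReal :=
  Filter.limsup (fun t => ((f t : ℝ) : EReal)) (𝓝[>] (0 : ℝ))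

/-- `lim_{t→∞} f(t)/t` as an extended real (for convex `f` the limit exists and equals
this limsup). -/
noncomputable def perspLimInfty (f : ℝ → ℝ) : EReal :=
  Filter.limsup (fun t => ((f t / t : ℝ) : EReal)) Filter.atTop

/-- The perspective function of `f`, with values in `EReal` and the convention
`0·(+∞) = 0` (the `EReal` convention). -/
noncomputable def persp (f : ℝ → ℝ) (x y : ℝ) : EReal :=
  if 0 < y then
    (if 0 < x then ((y * f (x / y) : ℝ) : EReal) else (y : EReal) * perspLimZero f)
  else if 0 < x then (x : EReal) * perspLimInfty f
  else 0

/-- The classical `f`-divergence `S_f^cl(p‖q) = Σ_x P_f(p(x), q(x))`. -/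
noncomputable def Sfcl {X : Type*} [Fintype X] (f : ℝ → ℝ) (p q : X → ℝ) : EReal :=
  ∑ x, persp f (p x) (q x)

/-- `(Γ, p, q)` is a reverse test for `(ρ, σ)`: `p, q` are nonzero nonnegative functions
on a finite set and `Γ` is a positive trace-preserving linear map with `Γ(p) = ρ`,
`Γ(q) = σ`. -/
def IsReverseTest {n : ℕ} (k : ℕ)
    (Γ : ((Fin k → ℂ) →ₗ[ℂ] Matrix (Fin n) (Fin n) ℂ)) (p q : Fin k → ℝ)
    (ρ σ : Matrix (Fin n) (Fin n) ℂ) : Prop :=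
  (∀ x, 0 ≤ p x) ∧ p ≠ 0 ∧ (∀ x, 0 ≤ q x) ∧ q ≠ 0 ∧
  (∀ r : Fin k → ℝ, (∀ x, 0 ≤ r x) → (Γ (fun x => (r x : ℂ))).PosSemidef) ∧
  (∀ v : Fin k → ℂ, (Γ v).trace = ∑ x, v x) ∧
  Γ (fun x => (p x : ℂ)) = ρ ∧ Γ (fun x => (q x : ℂ)) = σ

/-- Matsumoto's maximal `f`-divergence. -/
noncomputable def Sfmax {n : ℕ} (f : ℝ → ℝ) (ρ σ : Matrix (Fin n) (Fin n) ℂ) : EReal :=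
  sInf {y : EReal | ∃ (k : ℕ) (Γ : (Fin k → ℂ) →ₗ[ℂ] Matrix (Fin n) (Fin n) ℂ)
    (p q : Fin k → ℝ), IsReverseTest k Γ p q ρ σ ∧ y = Sfcl f p q}

section ConvexHull

variable {E : Type*} [AddCommGroup E] [Module ℝ E]

/-- In a finite-dimensional space, the convex hull is the image of a simplex of convex
combinations of boundedly many points (Carathéodory). -/
theorem convexHull_eq_image_stdSimplex [FiniteDimensional ℝ E] (s : Set E) :
    convexHull ℝ s =
      (fun u : (Fin (Module.finrank ℝ E + 1) → ℝ) × (Fin (Module.finrank ℝ E + 1) → E) =>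
        ∑ i, u.1 i • u.2 i) ''
        (stdSimplex ℝ (Fin (Module.finrank ℝ E + 1)) ×ˢ Set.univ.pi fun _ => s) := by
  apply Set.Subset.antisymm
  · intro x hx
    obtain ⟨κ, _, z, w, hzs, hz, hw, hw1, rfl⟩ := eq_pos_convex_span_of_mem_convexHull hx
    have hcard : Fintype.card κ ≤ Fintype.card (Fin (Module.finrank ℝ E + 1)) := by
      rw [Fintype.card_fin]
      exact hz.card_le_finrank_succ.trans (Nat.succ_le_succ (Submodule.finrank_le _))
    obtain ⟨e⟩ := Function.Embedding.nonempty_of_card_le hcard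
    have hκ : Nonempty κ := by
      by_contra h
      rw [not_nonempty_iff] at h
      simp at hw1
    obtain ⟨i₀⟩ := hκ
    refine ⟨(Function.extend e w 0, Function.extend e z fun _ => z i₀), ⟨⟨?_, ?_⟩, ?_⟩, ?_⟩
    · intro j
      by_cases hj : ∃ i, e i = j
      · obtain ⟨i, rfl⟩ := hj
        simpa [e.injective.extend_apply] using (hw i).le
      · simp [Function.extend_apply' _ _ _ hj]
    · rw [← hw1]
      refine (Fintype.sum_of_injective e e.injective _ _ (fun j hj => ?_) fun i => ?_).symm
      · exact Function.extend_apply' _ _ _ hj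
      · exact (e.injective.extend_apply _ _ _).symm
    · intro j _
      by_cases hj : ∃ i, e i = j
      · obtain ⟨i, rfl⟩ := hj
        simpa [e.injective.extend_apply] using hzs ⟨i, rfl⟩
      · simpa [Function.extend_apply' _ _ _ hj] using hzs ⟨i₀, rfl⟩
    · refine (Fintype.sum_of_injective e e.injective _ _ (fun j hj => ?_) fun i => ?_).symm
      · simp [Function.extend_apply' _ _ _ (show ¬∃ i, e i = j from hj)]
      · simp [e.injective.extend_apply]
  · rintro _ ⟨⟨w, z⟩, ⟨hw, hz⟩, rfl⟩
    exact (convex_convexHull ℝ s).sum_mem (fun i _ => hw.1 i) hw.2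
      fun i _ => subset_convexHull ℝ s (hz i trivial)

theorem isCompact_convexHull [TopologicalSpace E] [ContinuousAdd E] [ContinuousSMul ℝ E]
    [FiniteDimensional ℝ E] {s : Set E} (hs : IsCompact s) : IsCompact (convexHull ℝ s) := by
  rw [convexHull_eq_image_stdSimplex]
  refine ((isCompact_stdSimplex ℝ _).prod (isCompact_univ_pi fun _ => hs)).image ?_
  fun_prop

end ConvexHull

section Perspective

/-- The affine function `s ↦ a * s + b` lies below `f` on `(0,∞)`. -/
def IsAffineMinorant (f : ℝ → ℝ) (a b : ℝ) : Prop :=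
  ∀ s, 0 < s → a * s + b ≤ f s

variable {f : ℝ → ℝ}

theorem exists_isAffineMinorant_eq (hf : ConvexOn ℝ (Set.Ioi (0 : ℝ)) f) {s : ℝ} (hs : 0 < s) :
    ∃ a b, IsAffineMinorant f a b ∧ a * s + b = f s := by
  have hint : s ∈ interior (Set.Ioi (0 : ℝ)) := by rwa [interior_Ioi]
  set a := derivWithin f (Set.Ioi s) s with ha
  refine ⟨a, f s - a * s, fun t ht => ?_, by ring⟩
  rcases lt_trichotomy t s with h | rfl | h
  · have h1 := (hf.slope_le_leftDeriv_of_mem_interior ht hint h).trans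
      (hf.leftDeriv_le_rightDeriv_of_mem_interior hint)
    rw [slope_def_field, div_le_iff₀ (sub_pos.2 h)] at h1
    linarith
  · linarith
  · have h1 := hf.rightDeriv_le_slope_of_mem_interior hint ht h
    rw [slope_def_field, le_div_iff₀ (sub_pos.2 h)] at h1
    linarith

theorem IsAffineMinorant.le_perspLimZero {a b : ℝ} (h : IsAffineMinorant f a b) :
    (b : EReal) ≤ perspLimZero f := by
  have ht : Tendsto (fun s : ℝ => ((a * s + b : ℝ) : EReal)) (𝓝[>] 0) (𝓝 (b : EReal)) := by
    have : Tendsto (fun s : ℝ => a * s + b) (𝓝 0) (𝓝 (a * 0 + b)) :=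
      Continuous.tendsto (by fun_prop) 0
    rw [mul_zero, zero_add] at this
    exact (continuous_coe_real_ereal.tendsto b).comp (this.mono_left nhdsWithin_le_nhds)
  rw [← ht.limsup_eq]
  refine limsup_le_limsup ?_
  filter_upwards [self_mem_nhdsWithin] with s hs
  exact EReal.coe_le_coe_iff.2 (h s hs)

theorem IsAffineMinorant.le_perspLimInfty {a b : ℝ} (h : IsAffineMinorant f a b) :
    (a : EReal) ≤ perspLimInfty f := by
  have ht : Tendsto (fun s : ℝ => ((a + b / s : ℝ) : EReal)) atTop (𝓝 (a : EReal)) := by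
    have : Tendsto (fun s : ℝ => a + b / s) atTop (𝓝 (a + 0)) :=
      tendsto_const_nhds.add (tendsto_const_nhds.div_atTop tendsto_id)
    rw [add_zero] at this
    exact (continuous_coe_real_ereal.tendsto a).comp this
  rw [← ht.limsup_eq]
  refine limsup_le_limsup ?_
  filter_upwards [eventually_gt_atTop 0] with s hs
  refine EReal.coe_le_coe_iff.2 ?_
  rw [le_div_iff₀ hs, add_mul, div_mul_cancel₀ _ hs.ne']
  exact h s hs

theorem perspLimZero_le (hf : ConvexOn ℝ (Set.Ioi (0 : ℝ)) f) {c : ℝ}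
    (hc : ∀ a b, IsAffineMinorant f a b → b ≤ c) : perspLimZero f ≤ c := by
  have ht : Tendsto (fun s : ℝ => ((f 1 * s + c * (1 - s) : ℝ) : EReal)) (𝓝[>] 0)
      (𝓝 (c : EReal)) := by
    have : Tendsto (fun s : ℝ => f 1 * s + c * (1 - s)) (𝓝 0) (𝓝 (f 1 * 0 + c * (1 - 0))) :=
      Continuous.tendsto (by fun_prop) 0
    rw [mul_zero, zero_add, sub_zero, mul_one] at this
    exact (continuous_coe_real_ereal.tendsto c).comp (this.mono_left nhdsWithin_le_nhds)
  rw [← ht.limsup_eq]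
  refine limsup_le_limsup ?_
  filter_upwards [Ioo_mem_nhdsGT (zero_lt_one' ℝ)] with s hs
  refine EReal.coe_le_coe_iff.2 ?_
  obtain ⟨a, b, hab, hs'⟩ := exists_isAffineMinorant_eq hf hs.1
  have h1 := mul_le_mul_of_nonneg_right (hab 1 one_pos) hs.1.le
  have h2 := mul_le_mul_of_nonneg_right (hc a b hab) (sub_pos.2 hs.2).le
  linarith

theorem perspLimInfty_le (hf : ConvexOn ℝ (Set.Ioi (0 : ℝ)) f) {c : ℝ}
    (hc : ∀ a b, IsAffineMinorant f a b → a ≤ c) : perspLimInfty f ≤ c := by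
  have ht : Tendsto (fun s : ℝ => ((c * (1 - 1 / s) + f 1 / s : ℝ) : EReal)) atTop
      (𝓝 (c : EReal)) := by
    have : Tendsto (fun s : ℝ => c * (1 - 1 / s) + f 1 / s) atTop (𝓝 (c * (1 - 0) + 0)) :=
      ((tendsto_const_nhds.sub (tendsto_const_nhds.div_atTop tendsto_id)).const_mul c).add
        (tendsto_const_nhds.div_atTop tendsto_id)
    rw [sub_zero, mul_one, add_zero] at this
    exact (continuous_coe_real_ereal.tendsto c).comp this
  rw [← ht.limsup_eq]
  refine limsup_le_limsup ?_
  filter_upwards [eventually_gt_atTop 1] with s hs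
  have hs0 : 0 < s := one_pos.trans hs
  refine EReal.coe_le_coe_iff.2 ?_
  obtain ⟨a, b, hab, hs'⟩ := exists_isAffineMinorant_eq hf hs0
  have h1 := hab 1 one_pos
  have h2 := mul_le_mul_of_nonneg_right (hc a b hab) (sub_pos.2 hs).le
  rw [div_le_iff₀ hs0]
  have : (c * (1 - 1 / s) + f 1 / s) * s = c * (s - 1) + f 1 := by field_simp
  linarith

/-- The perspective of a convex function is the supremum of the linear functions induced by
the affine minorants. -/
theorem persp_le_iff (hf : ConvexOn ℝ (Set.Ioi (0 : ℝ)) f) {x y : ℝ} (hx : 0 ≤ x) (hy : 0 ≤ y)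
    (r : ℝ) : persp f x y ≤ r ↔ ∀ a b, IsAffineMinorant f a b → a * x + b * y ≤ r := by
  unfold persp
  have key : ∀ {t : ℝ} {L : EReal}, 0 < t → ((t : EReal) * L ≤ r ↔ L ≤ ((r / t : ℝ) : EReal)) := by
    intro t L ht
    rw [EReal.coe_div, EReal.le_div_iff_mul_le (by exact_mod_cast ht) (EReal.coe_ne_top t),
      mul_comm]
  rcases hy.eq_or_lt with rfl | hy
  · rcases hx.eq_or_lt with rfl | hx
    · obtain ⟨a, b, hab, -⟩ := exists_isAffineMinorant_eq hf one_pos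
      simp only [lt_irrefl, if_false, mul_zero, add_zero]
      exact ⟨fun h _ _ _ => by exact_mod_cast h, fun h => by exact_mod_cast h a b hab⟩
    · simp only [lt_irrefl, hx, if_false, if_true, mul_zero, add_zero]
      rw [key hx]
      constructor
      · intro h a b hab
        exact (le_div_iff₀ hx).1 (EReal.coe_le_coe_iff.1 (hab.le_perspLimInfty.trans h))
      · exact fun h => perspLimInfty_le hf fun a b hab => (le_div_iff₀ hx).2 (h a b hab)
  · rcases hx.eq_or_lt with rfl | hx
    · simp only [lt_irrefl, hy, if_false, if_true, mul_zero, zero_add]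
      rw [key hy]
      constructor
      · intro h a b hab
        exact (le_div_iff₀ hy).1 (EReal.coe_le_coe_iff.1 (hab.le_perspLimZero.trans h))
      · exact fun h => perspLimZero_le hf fun a b hab => (le_div_iff₀ hy).2 (h a b hab)
    · simp only [hx, hy, if_true, EReal.coe_le_coe_iff]
      have hxy : y * (x / y) = x := mul_div_cancel₀ _ hy.ne'
      constructor
      · intro h a b hab
        have := mul_le_mul_of_nonneg_left (hab _ (div_pos hx hy)) hy.le
        have e : y * (a * (x / y) + b) = a * (y * (x / y)) + b * y := by ring
        rw [e, hxy] at this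
        exact this.trans h
      · intro h
        obtain ⟨a, b, hab, he⟩ := exists_isAffineMinorant_eq hf (div_pos hx hy)
        have e : y * (a * (x / y) + b) = a * (y * (x / y)) + b * y := by ring
        rw [← he, e, hxy]
        exact h a b hab

theorem persp_mul_le (hf : ConvexOn ℝ (Set.Ioi (0 : ℝ)) f) {x y r t : ℝ} (hx : 0 ≤ x)
    (hy : 0 ≤ y) (ht : 0 ≤ t) (h : persp f x y ≤ r) :
    persp f (t * x) (t * y) ≤ ((t * r : ℝ) : EReal) := by
  rw [persp_le_iff hf hx hy] at h
  rw [persp_le_iff hf (mul_nonneg ht hx) (mul_nonneg ht hy)]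
  intro a b hab
  have := mul_le_mul_of_nonneg_left (h a b hab) ht
  linarith

theorem exists_persp_lower_bound (hf : ConvexOn ℝ (Set.Ioi (0 : ℝ)) f) :
    ∃ M : ℝ, ∀ x y r : ℝ, 0 ≤ x → 0 ≤ y → persp f x y ≤ r → -(M * (x + y)) ≤ r := by
  obtain ⟨a, b, hab, -⟩ := exists_isAffineMinorant_eq hf one_pos
  refine ⟨|a| + |b|, fun x y r hx hy h => ?_⟩
  have h1 := (persp_le_iff hf hx hy r).1 h a b hab
  nlinarith [neg_abs_le a, neg_abs_le b, abs_nonneg a, abs_nonneg b]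

theorem isClosed_persp_le (hf : ConvexOn ℝ (Set.Ioi (0 : ℝ)) f) :
    IsClosed {v : ℝ × ℝ × ℝ | 0 ≤ v.1 ∧ 0 ≤ v.2.1 ∧ persp f v.1 v.2.1 ≤ v.2.2} := by
  have h : {v : ℝ × ℝ × ℝ | 0 ≤ v.1 ∧ 0 ≤ v.2.1 ∧ persp f v.1 v.2.1 ≤ v.2.2} =
      {v | 0 ≤ v.1} ∩ {v | 0 ≤ v.2.1} ∩
        ⋂ (a : ℝ) (b : ℝ) (_ : IsAffineMinorant f a b), {v | a * v.1 + b * v.2.1 ≤ v.2.2} := by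
    ext v
    simp only [Set.mem_inter_iff, Set.mem_ofPred_eq, Set.mem_iInter, and_assoc]
    exact and_congr_right fun hx => and_congr_right fun hy => persp_le_iff hf hx hy _
  rw [h]
  refine ((isClosed_le (by fun_prop) (by fun_prop)).inter
    (isClosed_le (by fun_prop) (by fun_prop))).inter ?_
  exact isClosed_iInter fun a => isClosed_iInter fun b => isClosed_iInter fun _ =>
    isClosed_le (by fun_prop) (by fun_prop)

theorem persp_ne_bot (hf : ConvexOn ℝ (Set.Ioi (0 : ℝ)) f) {x y : ℝ} (hx : 0 ≤ x)
    (hy : 0 ≤ y) : persp f x y ≠ ⊥ := by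
  intro h
  obtain ⟨M, hM⟩ := exists_persp_lower_bound hf
  have := hM x y (-(M * (x + y)) - 1) hx hy (h ▸ bot_le)
  linarith

end Perspective

/-- A finite family in `EReal` avoiding `⊥` whose sum is at most the real number `c` is
dominated by a real family summing to `c`. -/
theorem exists_real_sum_eq_of_sum_le {k : ℕ} (hk : 0 < k) {u : Fin k → EReal}
    (hu : ∀ x, u x ≠ ⊥) {c : ℝ} (h : ∑ x, u x ≤ c) :
    ∃ r : Fin k → ℝ, (∀ x, u x ≤ r x) ∧ ∑ x, r x = c := by
  have hbot : ∀ s : Finset (Fin k), ∑ x ∈ s, u x ≠ ⊥ := fun s =>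
    Finset.sum_induction u (· ≠ ⊥) (fun a b ha hb => by simp [EReal.add_eq_bot_iff, ha, hb])
      (by simp) fun x _ => hu x
  have htop : ∀ x, u x ≠ ⊤ := by
    intro x hx
    rw [← Finset.add_sum_erase _ _ (Finset.mem_univ x), hx,
      EReal.top_add_of_ne_bot (hbot _)] at h
    exact (EReal.coe_lt_top c).not_ge h
  lift u to Fin k → ℝ using fun x => ⟨htop x, hu x⟩
  have hcoe : ∀ s : Finset (Fin k), ∑ x ∈ s, (u x : EReal) = ((∑ x ∈ s, u x : ℝ) : EReal) := by
    intro s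
    induction s using Finset.induction_on with
    | empty => simp
    | insert a s ha ih => rw [Finset.sum_insert ha, Finset.sum_insert ha, ih, EReal.coe_add]
  rw [hcoe, EReal.coe_le_coe_iff] at h
  have hk' : (k : ℝ) ≠ 0 := by positivity
  refine ⟨fun x => u x + (c - ∑ x, u x) / k, fun x => ?_, ?_⟩
  · rw [EReal.coe_le_coe_iff]
    have : 0 ≤ (c - ∑ x, u x) / k := div_nonneg (sub_nonneg.2 h) (Nat.cast_nonneg k)
    linarith
  · rw [Finset.sum_add_distrib, Finset.sum_const, Finset.card_univ, Fintype.card_fin,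
      nsmul_eq_mul, mul_div_cancel₀ _ hk']
    ring

section Generators

variable {n : ℕ} {f : ℝ → ℝ}

/-- The density matrices: positive semidefinite matrices of unit trace. -/
def densityMatrices (n : ℕ) : Set (Matrix (Fin n) (Fin n) ℂ) :=
  {A | A.PosSemidef ∧ A.trace = 1}

theorem trace_conjTranspose_mul_self_eq_sum (C : Matrix (Fin n) (Fin n) ℂ) :
    (C.conjTranspose * C).trace = ((∑ j, ∑ i, ‖C i j‖ ^ 2 : ℝ) : ℂ) := by
  simp [Matrix.trace, Matrix.mul_apply, Complex.conj_mul']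

open scoped MatrixOrder Matrix.Norms.L2Operator in
theorem exists_eq_conjTranspose_mul_self {A : Matrix (Fin n) (Fin n) ℂ} (hA : A.PosSemidef) :
    ∃ C : Matrix (Fin n) (Fin n) ℂ, A = C.conjTranspose * C :=
  CStarAlgebra.nonneg_iff_eq_star_mul_self.mp hA.nonneg

theorem isCompact_densityMatrices (n : ℕ) : IsCompact (densityMatrices n) := by
  have hcpt : IsCompact {C : Fin n → Fin n → ℂ | ∑ j, ∑ i, ‖C i j‖ ^ 2 = 1} := by
    refine (isCompact_univ_pi fun _ : Fin n => isCompact_univ_pi fun _ : Fin n =>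
      isCompact_closedBall (0 : ℂ) 1).of_isClosed_subset
      (isClosed_eq (by fun_prop) continuous_const) ?_
    intro C hC i _ j _
    have hC : ∑ j, ∑ i, ‖C i j‖ ^ 2 = 1 := hC
    have h1 : ‖C i j‖ ^ 2 ≤ 1 := by
      rw [← hC]
      refine le_trans ?_ (Finset.single_le_sum (f := fun j => ∑ i, ‖C i j‖ ^ 2)
        (fun _ _ => by positivity) (Finset.mem_univ j))
      exact Finset.single_le_sum (f := fun i => ‖C i j‖ ^ 2)
        (fun _ _ => by positivity) (Finset.mem_univ i)
    rw [mem_closedBall_zero_iff]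
    exact (sq_le_one_iff₀ (norm_nonneg _)).1 h1
  have himg : densityMatrices n =
      (fun C : Fin n → Fin n → ℂ => (Matrix.of C).conjTranspose * Matrix.of C) ''
        {C | ∑ j, ∑ i, ‖C i j‖ ^ 2 = 1} := by
    ext A
    constructor
    · rintro ⟨hA, ht⟩
      obtain ⟨C, rfl⟩ := exists_eq_conjTranspose_mul_self hA
      rw [trace_conjTranspose_mul_self_eq_sum] at ht
      exact ⟨C, by exact_mod_cast ht, rfl⟩
    · rintro ⟨C, hC, rfl⟩
      have hC : ∑ j, ∑ i, ‖C i j‖ ^ 2 = 1 := hC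
      refine ⟨Matrix.posSemidef_conjTranspose_mul_self _, ?_⟩
      rw [trace_conjTranspose_mul_self_eq_sum]
      simp only [Matrix.of_apply, hC, Complex.ofReal_one]
  rw [himg]
  refine hcpt.image ?_
  have h : Continuous fun C : Fin n → Fin n → ℂ => (Matrix.of C) := continuous_id
  exact h.matrix_conjTranspose.matrix_mul h

/-- Points `(x • A, y • A, r)` with `A` a density matrix and `persp f x y ≤ r`, normalized by
`(M + 1) * (x + y) + r = 1`. They generate the cone which is the epigraph of `Sfmax f`. -/
def epigraphGenerators (n : ℕ) (f : ℝ → ℝ) (M : ℝ) :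
    Set (Matrix (Fin n) (Fin n) ℂ × Matrix (Fin n) (Fin n) ℂ × ℝ) :=
  (fun u : (ℝ × ℝ × ℝ) × Matrix (Fin n) (Fin n) ℂ => (u.1.1 • u.2, u.1.2.1 • u.2, u.1.2.2)) ''
    ({v | (0 ≤ v.1 ∧ 0 ≤ v.2.1 ∧ persp f v.1 v.2.1 ≤ v.2.2) ∧
      (M + 1) * (v.1 + v.2.1) + v.2.2 = 1} ×ˢ densityMatrices n)

theorem isCompact_epigraphGenerators (hf : ConvexOn ℝ (Set.Ioi (0 : ℝ)) f) {M : ℝ} (hM0 : 0 ≤ M)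
    (hM : ∀ x y r : ℝ, 0 ≤ x → 0 ≤ y → persp f x y ≤ r → -(M * (x + y)) ≤ r) :
    IsCompact (epigraphGenerators n f M) := by
  refine IsCompact.image (IsCompact.prod ?_ (isCompact_densityMatrices n)) (by fun_prop)
  refine IsCompact.of_isClosed_subset
    (isCompact_Icc.prod (isCompact_Icc.prod isCompact_Icc) :
      IsCompact (Set.Icc (0 : ℝ) 1 ×ˢ Set.Icc (0 : ℝ) 1 ×ˢ Set.Icc (-M) 1))
    ((isClosed_persp_le hf).inter (isClosed_eq (by fun_prop) continuous_const)) ?_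
  rintro ⟨x, y, r⟩ ⟨⟨hx, hy, hp⟩, he⟩
  have hr := hM x y r hx hy hp
  simp only at hx hy he
  refine ⟨⟨hx, by linarith⟩, ⟨hy, by linarith⟩, ?_, ?_⟩
  · nlinarith
  · have : 0 ≤ (M + 1) * (x + y) := by positivity
    show r ≤ 1
    linarith

theorem Sfmax_le_of_mem_convexHull (hf : ConvexOn ℝ (Set.Ioi (0 : ℝ)) f) {M c L : ℝ}
    (hL : 0 < L) {ρ σ : Matrix (Fin n) (Fin n) ℂ} (hρ : ρ ≠ 0) (hσ : σ ≠ 0)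
    (h : L⁻¹ • (ρ, σ, c) ∈ convexHull ℝ (epigraphGenerators n f M)) : Sfmax f ρ σ ≤ c := by
  obtain ⟨κ, _, w, z, hw, -, hz, hsum⟩ := mem_convexHull_iff_exists_fintype.1 h
  let e := Fintype.equivFin κ
  choose u hu hzu using hz
  replace hsum : ∑ i, (L * w i) • z i = (ρ, σ, c) := by
    simp_rw [mul_smul]
    rw [← Finset.smul_sum, hsum, smul_smul, mul_inv_cancel₀ hL.ne', one_smul]
  replace hsum : ∑ j, (L * w (e.symm j)) • z (e.symm j) = (ρ, σ, c) := by
    rw [← hsum]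
    exact e.symm.sum_comp fun i => (L * w i) • z i
  have hLw : ∀ j, 0 ≤ L * w (e.symm j) := fun j => mul_nonneg hL.le (hw _)
  set p : Fin (Fintype.card κ) → ℝ := fun j => L * w (e.symm j) * (u (e.symm j)).1.1 with hp
  set q : Fin (Fintype.card κ) → ℝ := fun j => L * w (e.symm j) * (u (e.symm j)).1.2.1 with hq
  set A : Fin (Fintype.card κ) → Matrix (Fin n) (Fin n) ℂ := fun j => (u (e.symm j)).2 with hA
  have hρe : ∑ j, (p j : ℂ) • A j = ρ := by
    have := congrArg (fun v => v.1) hsum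
    simp only [Prod.fst_sum] at this
    rw [← this]
    refine Finset.sum_congr rfl fun j _ => ?_
    rw [← hzu, Complex.coe_smul, Prod.smul_fst, hp, mul_smul]
  have hσe : ∑ j, (q j : ℂ) • A j = σ := by
    have := congrArg (fun v => v.2.1) hsum
    simp only [Prod.snd_sum, Prod.fst_sum] at this
    rw [← this]
    refine Finset.sum_congr rfl fun j _ => ?_
    rw [← hzu, Complex.coe_smul, Prod.smul_snd, Prod.smul_fst, hq, mul_smul]
  have hce : ∑ j, L * w (e.symm j) * (u (e.symm j)).1.2.2 = c := by
    have := congrArg (fun v => v.2.2) hsum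
    simp only [Prod.snd_sum] at this
    rw [← this]
    refine Finset.sum_congr rfl fun j _ => ?_
    rw [← hzu, Prod.smul_snd, Prod.smul_snd, smul_eq_mul]
  have hcost : Sfcl f p q ≤ c := by
    have hcoe : (c : EReal) =
        ∑ j, ((L * w (e.symm j) * (u (e.symm j)).1.2.2 : ℝ) : EReal) := by
      rw [← hce]
      induction (Finset.univ : Finset (Fin (Fintype.card κ))) using Finset.induction_on with
      | empty => simp
      | insert a s ha ih => rw [Finset.sum_insert ha, Finset.sum_insert ha, EReal.coe_add, ih]
    rw [hcoe]
    refine Finset.sum_le_sum fun j _ => ?_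
    obtain ⟨⟨⟨hx, hy, hr⟩, -⟩, -⟩ := hu (e.symm j)
    exact persp_mul_le hf hx hy (hLw j) hr
  refine le_trans (sInf_le ⟨_, Fintype.linearCombination ℂ A, p, q, ⟨fun j => ?_, ?_,
    fun j => ?_, ?_, fun r hr => ?_, fun v => ?_, ?_, ?_⟩, rfl⟩) hcost
  · exact mul_nonneg (hLw j) (hu _).1.1.1
  · intro h0
    exact hρ (by rw [← hρe, h0]; simp)
  · exact mul_nonneg (hLw j) (hu _).1.1.2.1
  · intro h0
    exact hσ (by rw [← hσe, h0]; simp)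
  · rw [Fintype.linearCombination_apply]
    exact Matrix.posSemidef_sum _ fun j _ => (hu (e.symm j)).2.1.smul (by exact_mod_cast hr j)
  · rw [Fintype.linearCombination_apply, Matrix.trace_sum]
    refine Finset.sum_congr rfl fun j _ => ?_
    rw [Matrix.trace_smul, (hu (e.symm j)).2.2, smul_eq_mul, mul_one]
  · rw [Fintype.linearCombination_apply, hρe]
  · rw [Fintype.linearCombination_apply, hσe]

theorem IsReverseTest.mem_convexHull (hf : ConvexOn ℝ (Set.Ioi (0 : ℝ)) f) {M c : ℝ}
    (hM : ∀ x y r : ℝ, 0 ≤ x → 0 ≤ y → persp f x y ≤ r → -(M * (x + y)) ≤ r)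
    {ρ σ : Matrix (Fin n) (Fin n) ℂ} {k : ℕ}
    {Γ : (Fin k → ℂ) →ₗ[ℂ] Matrix (Fin n) (Fin n) ℂ} {p q : Fin k → ℝ}
    (h : IsReverseTest k Γ p q ρ σ) (hc : Sfcl f p q ≤ c) :
    ((M + 1) * (reTrace ρ + reTrace σ) + c)⁻¹ • (ρ, σ, c) ∈
      convexHull ℝ (epigraphGenerators n f M) := by
  obtain ⟨hp, hp0, hq, -, hpos, htr, hρ, hσ⟩ := h
  obtain ⟨x₀, hx₀⟩ := Function.ne_iff.1 hp0
  obtain ⟨r, hr, hrc⟩ := exists_real_sum_eq_of_sum_le (Fin.pos x₀)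
    (fun x => persp_ne_bot hf (hp x) (hq x)) hc
  set A : Fin k → Matrix (Fin n) (Fin n) ℂ := fun x => Γ (Pi.single x 1) with hA
  have hAd : ∀ x, A x ∈ densityMatrices n := by
    intro x
    refine ⟨?_, ?_⟩
    · have := hpos (Pi.single x 1) fun y => by
        by_cases hy : y = x
        · subst hy; simp
        · simp [hy]
      convert this using 2
      ext y
      by_cases hy : y = x
      · subst hy; simp
      · simp [hy]
    · rw [hA, htr, Finset.sum_pi_single']
      simp
  have hΓ : ∀ s : Fin k → ℝ, Γ (fun x => (s x : ℂ)) = ∑ x, s x • A x := by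
    intro s
    rw [LinearMap.pi_apply_eq_sum_univ Γ]
    refine Finset.sum_congr rfl fun x _ => ?_
    rw [Complex.coe_smul, hA]
    congr 2
    ext y
    simp [Pi.single_apply, eq_comm]
  have htrace : ∀ s : Fin k → ℝ, reTrace (Γ (fun x => (s x : ℂ))) = ∑ x, s x := by
    intro s
    simp [reTrace, htr]
  set l : Fin k → ℝ := fun x => (M + 1) * (p x + q x) + r x with hl
  have hsl : (M + 1) * (reTrace ρ + reTrace σ) + c = ∑ x, l x := by
    rw [← hρ, ← hσ, htrace, htrace, ← hrc, ← Finset.sum_add_distrib, Finset.mul_sum,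
      ← Finset.sum_add_distrib]
  have hpl : ∀ x, p x + q x ≤ l x := by
    intro x
    have := hM _ _ _ (hp x) (hq x) (hr x)
    simp only [hl]
    linarith
  have hl0 : ∀ x, 0 ≤ l x := fun x => (add_nonneg (hp x) (hq x)).trans (hpl x)
  have hlpos : 0 < ∑ x, l x := by
    refine Finset.sum_pos' (fun x _ => hl0 x) ⟨x₀, Finset.mem_univ _, ?_⟩
    have := (hp x₀).lt_of_ne' hx₀
    linarith [hpl x₀, hq x₀]
  set z : Fin k → Matrix (Fin n) (Fin n) ℂ × Matrix (Fin n) (Fin n) ℂ × ℝ := fun x =>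
    if l x = 0 then (0, 0, 1) else (l x)⁻¹ • (p x • A x, q x • A x, r x) with hz
  have hmem := Finset.univ.centerMass_mem_convexHull (R := ℝ) (fun x _ => hl0 x) hlpos
    (z := z) (s := epigraphGenerators n f M) fun x _ => by
      by_cases hx : l x = 0
      · simp only [hz, hx, if_true]
        refine ⟨((0, 0, 1), A x), ⟨⟨⟨le_rfl, le_rfl, ?_⟩, by simp⟩, hAd x⟩, by simp⟩
        simp [persp]
      · simp only [hz, hx, if_false]
        have hi : 0 ≤ (l x)⁻¹ := inv_nonneg.2 (hl0 x)
        refine ⟨(((l x)⁻¹ * p x, (l x)⁻¹ * q x, (l x)⁻¹ * r x), A x), ⟨⟨⟨mul_nonneg hi (hp x),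
          mul_nonneg hi (hq x), persp_mul_le hf (hp x) (hq x) hi (hr x)⟩, ?_⟩, hAd x⟩, ?_⟩
        · have : (l x)⁻¹ * ((M + 1) * (p x + q x) + r x) = 1 := inv_mul_cancel₀ hx
          simp only
          linarith
        · simp [mul_smul]
  have hlz : ∀ x, l x • z x = (p x • A x, q x • A x, r x) := by
    intro x
    by_cases hx : l x = 0
    · have hp' : p x = 0 := by linarith [hpl x, hp x, hq x]
      have hq' : q x = 0 := by linarith [hpl x, hp x, hq x]
      have hr' : r x = 0 := by simpa [hl, hp', hq'] using hx
      simp only [hx, hp', hq', hr', zero_smul]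
      rfl
    · simp only [hz, hx, if_false]
      rw [smul_smul, mul_inv_cancel₀ hx, one_smul]
  rw [hsl]
  convert hmem using 1
  rw [Finset.centerMass]
  congr 1
  simp_rw [hlz]
  rw [← hρ, ← hσ, hΓ, hΓ, ← hrc]
  ext1
  · simp [Prod.fst_sum]
  · ext1 <;> simp [Prod.fst_sum, Prod.snd_sum]

end Generators

theorem reTrace_pos {n : ℕ} {A : Matrix (Fin n) (Fin n) ℂ} (hA : PSDne A) : 0 < reTrace A := by
  have h0 : 0 ≤ A.trace := hA.1.trace_nonneg
  have hne : A.trace ≠ 0 := fun h => hA.2 (hA.1.trace_eq_zero_iff.1 h)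
  exact (Complex.pos_iff.1 (h0.lt_of_ne' hne)).1

/-- For a convex `f : (0,∞) → ℝ`, the maximal `f`-divergence is jointly
lower semicontinuous on pairs of nonzero PSD operators. -/
theorem Sfmax_lowerSemicontinuousOn {n : ℕ} (f : ℝ → ℝ)
    (hf : ConvexOn ℝ (Set.Ioi (0 : ℝ)) f) :
    LowerSemicontinuousOn
      (fun p : Matrix (Fin n) (Fin n) ℂ × Matrix (Fin n) (Fin n) ℂ => Sfmax f p.1 p.2)
      {p : Matrix (Fin n) (Fin n) ℂ × Matrix (Fin n) (Fin n) ℂ | PSDne p.1 ∧ PSDne p.2} := by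
  rintro ⟨ρ, σ⟩ ⟨hρ, hσ⟩ y hy
  obtain ⟨c, hyc, hc⟩ := EReal.lt_iff_exists_real_btwn.1 hy
  obtain ⟨M₀, hM₀⟩ := exists_persp_lower_bound hf
  have hT : 0 < reTrace ρ + reTrace σ := add_pos (reTrace_pos hρ) (reTrace_pos hσ)
  obtain ⟨M, hM0, hMM₀, hMc⟩ : ∃ M : ℝ, 0 ≤ M ∧ M₀ ≤ M ∧ -c ≤ M * (reTrace ρ + reTrace σ) := by
    refine ⟨max 0 (max M₀ (-c / (reTrace ρ + reTrace σ))), le_max_left _ _,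
      (le_max_left _ _).trans (le_max_right _ _), ?_⟩
    rw [← div_le_iff₀ hT]
    exact (le_max_right _ _).trans (le_max_right _ _)
  have hM : ∀ x y r : ℝ, 0 ≤ x → 0 ≤ y → persp f x y ≤ r → -(M * (x + y)) ≤ r := by
    intro x y r hx hy h
    have := mul_le_mul_of_nonneg_right hMM₀ (add_nonneg hx hy)
    linarith [hM₀ x y r hx hy h]
  have hL : 0 < (M + 1) * (reTrace ρ + reTrace σ) + c := by linarith
  have hcpt : IsCompact (convexHull ℝ (epigraphGenerators n f M)) :=
    isCompact_convexHull (isCompact_epigraphGenerators hf hM0 hM)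
  have hnot : ((M + 1) * (reTrace ρ + reTrace σ) + c)⁻¹ • (ρ, σ, c) ∉
      convexHull ℝ (epigraphGenerators n f M) := fun h =>
    hc.not_ge (Sfmax_le_of_mem_convexHull hf hL hρ.2 hσ.2 h)
  have htr : Continuous (reTrace : Matrix (Fin n) (Fin n) ℂ → ℝ) :=
    Complex.continuous_re.comp continuous_id.matrix_trace
  have hcont : ContinuousAt
      (fun P : Matrix (Fin n) (Fin n) ℂ × Matrix (Fin n) (Fin n) ℂ =>
        ((M + 1) * (reTrace P.1 + reTrace P.2) + c)⁻¹ • (P.1, P.2, c)) (ρ, σ) := by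
    have hLc : Continuous fun P : Matrix (Fin n) (Fin n) ℂ × Matrix (Fin n) (Fin n) ℂ =>
        (M + 1) * (reTrace P.1 + reTrace P.2) + c := by fun_prop
    exact (hLc.continuousAt.inv₀ hL.ne').smul (Continuous.continuousAt (by fun_prop))
  filter_upwards [nhdsWithin_le_nhds (hcont.eventually (hcpt.isClosed.isOpen_compl.mem_nhds hnot))]
    with P hP
  by_contra hlt
  obtain ⟨_, ⟨k, Γ, p, q, hrt, rfl⟩, hlt'⟩ := sInf_lt_iff.1 ((not_lt.1 hlt).trans_lt hyc)
  exact hP (hrt.mem_convexHull hf hM hlt'.le)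

end QRenyi

end
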